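/- Let F = FreeGroup X be a free group on an infinite type X. Then the subgroup Inn F of inner automorphisms of F is a normal subgroup of Aut F of cardinality #X, and every normal subgroup N of Aut F whose cardinality is at most #X is contained in Inn F; thus Inn F is the largest normal subgroup of Aut F of cardinality #X. -/

import Mathlib

open Cardinal

namespace FreeGroup

variable {X : Type*}

theorem mk_mem_zpowers_of {y : X} {L : List (X × Bool)} (h : ∀ a ∈ L, a.1 = y) :
    mk L ∈ Subgroup.zpowers (of y) := by
  induction L with
  | nil => exact one_mem _
  | cons a L ih =>
    rw [← List.singleton_append, ← mul_mk]
    refine mul_mem ?_ (ih fun b hb => h b (List.mem_cons_of_mem _ hb))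
    obtain ⟨x, b⟩ := a
    obtain rfl : x = y := h _ List.mem_cons_self
    cases b
    · exact inv_mem (Subgroup.mem_zpowers (of x))
    · exact Subgroup.mem_zpowers (of x)

section LetterCount

variable [DecidableEq X] (p : X → Bool)

/-- The number of letters of the reduced word of `g` whose generator satisfies `p`. -/
def letterCount (g : FreeGroup X) : ℕ := g.toWord.countP fun a => p a.1

theorem letterCount_mk_le (L : List (X × Bool)) :
    letterCount p (mk L) ≤ L.countP fun a => p a.1 := by
  rw [letterCount, toWord_mk]
  exact reduce.red.sublist.countP_le

theorem letterCount_mul_le (g h : FreeGroup X) :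
    letterCount p (g * h) ≤ letterCount p g + letterCount p h := by
  simpa only [letterCount, List.countP_append] using (toWord_mul_sublist g h).countP_le

theorem letterCount_inv (g : FreeGroup X) : letterCount p g⁻¹ = letterCount p g := by
  rw [letterCount, letterCount, toWord_inv, invRev, List.countP_reverse, List.countP_map]
  rfl

theorem letterCount_pow_le (g : FreeGroup X) (n : ℕ) :
    letterCount p (g ^ n) ≤ n * letterCount p g := by
  induction n with
  | zero => simp [letterCount]
  | succ n ih =>
    rw [pow_succ, add_one_mul]
    exact (letterCount_mul_le p _ _).trans (by gcongr)

theorem letterCount_zpow_le (g : FreeGroup X) (n : ℤ) :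
    letterCount p (g ^ n) ≤ n.natAbs * letterCount p g := by
  obtain ⟨n, rfl | rfl⟩ := n.eq_nat_or_neg
  · simpa using letterCount_pow_le p g n
  · simpa [letterCount_inv] using letterCount_pow_le p g n

theorem mul_countP_reduceCyclically_le (g : FreeGroup X) (n : ℕ) :
    n * (reduceCyclically g.toWord).countP (fun a => p a.1) ≤ letterCount p (g ^ n) := by
  rcases Nat.eq_zero_or_pos n with rfl | hn
  · simp
  · rw [letterCount, toWord_pow, reduceCyclically.reduce_flatten_replicate isReduced_toWord,
      if_neg hn.ne']
    simp only [List.countP_append, List.countP_flatten, List.map_replicate, List.sum_replicate,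
      smul_eq_mul]
    omega

theorem countP_reduceCyclically_eq_zero {g : FreeGroup X} {K : ℕ}
    (h : ∀ n : ℕ, letterCount p (g ^ n) ≤ K) :
    (reduceCyclically g.toWord).countP (fun a => p a.1) = 0 := by
  by_contra hne
  have h₁ := (mul_countP_reduceCyclically_le p g (K + 1)).trans (h (K + 1))
  have h₂ := Nat.le_mul_of_pos_right (K + 1) (Nat.pos_of_ne_zero hne)
  omega

theorem length_le_of_isCyclicallyReduced {L : List (X × Bool)} (hL : IsCyclicallyReduced L)
    {c g : FreeGroup X} (h : mk L = c * g * c⁻¹) : L.length ≤ norm g := by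
  have hn (n : ℕ) : n * L.length ≤ 2 * norm c + n * norm g := by
    have h₁ : norm (mk L ^ n) = n * L.length := by
      rw [pow_mk, norm, toWord_mk, (hL.flatten_replicate n).isReduced.reduce_eq]
      simp
    have h₂ : norm (g ^ n) ≤ n * norm g := by
      simpa [letterCount, norm] using letterCount_pow_le (fun _ => true) g n
    have h₃ : norm (mk L ^ n) ≤ norm c + norm (g ^ n) + norm c⁻¹ := by
      rw [h, conj_pow]
      exact (norm_mul_le _ _).trans (by gcongr; exact norm_mul_le _ _)
    rw [norm_inv_eq] at h₃
    omega
  by_contra! hlt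
  have h₁ := hn (2 * norm c + 1)
  have h₂ := Nat.mul_le_mul_left (2 * norm c + 1) (Nat.succ_le_of_lt hlt)
  rw [Nat.succ_eq_add_one, mul_add] at h₂
  omega

theorem exists_conj_zpow_of_letterCount_le {g : FreeGroup X} {y : X} {K : ℕ}
    (h : ∀ n : ℕ, letterCount (fun x => decide (x ≠ y)) (g ^ n) ≤ K) :
    ∃ (k : ℤ) (c : FreeGroup X), g = c * of y ^ k * c⁻¹ := by
  have h₀ := countP_reduceCyclically_eq_zero _ h
  rw [List.countP_eq_zero] at h₀
  obtain ⟨k, hk⟩ := mk_mem_zpowers_of (y := y) (L := reduceCyclically g.toWord)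
    (fun a ha => by simpa using h₀ a ha)
  refine ⟨k, mk (reduceCyclically.conjugator g.toWord), ?_⟩
  dsimp only at hk
  rw [hk, inv_mk, mul_mk, mul_mk, reduceCyclically.conj_conjugator_reduceCyclically, mk_toWord]

end LetterCount

section Transvection

variable [DecidableEq X]

/-- The endomorphism fixing the generator `y` and sending every other generator `x` to
`x * y ^ m x`. -/
def transvectionHom (y : X) (m : X → ℤ) : FreeGroup X →* FreeGroup X :=
  lift fun x => if x = y then of y else of x * of y ^ m x

theorem transvectionHom_of_self (y : X) (m : X → ℤ) : transvectionHom y m (of y) = of y := by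
  simp [transvectionHom]

theorem transvectionHom_of_ne {x y : X} (h : x ≠ y) (m : X → ℤ) :
    transvectionHom y m (of x) = of x * of y ^ m x := by
  simp [transvectionHom, h]

theorem transvectionHom_comp (y : X) (m n : X → ℤ) :
    (transvectionHom y m).comp (transvectionHom y n) = transvectionHom y (m + n) := by
  ext x
  by_cases h : x = y
  · subst h
    simp [transvectionHom_of_self]
  · simp [transvectionHom_of_self, transvectionHom_of_ne h, zpow_add, mul_assoc]

theorem transvectionHom_zero (y : X) : transvectionHom y 0 = MonoidHom.id (FreeGroup X) := by
  ext x
  by_cases h : x = y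
  · subst h
    simp [transvectionHom_of_self]
  · simp [transvectionHom_of_ne h]

/-- `transvectionHom` as an automorphism. -/
def transvection (y : X) (m : X → ℤ) : MulAut (FreeGroup X) :=
  MonoidHom.toMulEquiv (transvectionHom y m) (transvectionHom y (-m))
    (by rw [transvectionHom_comp, neg_add_cancel, transvectionHom_zero])
    (by rw [transvectionHom_comp, add_neg_cancel, transvectionHom_zero])

@[simp]
theorem transvection_of_self (y : X) (m : X → ℤ) : transvection y m (of y) = of y :=
  transvectionHom_of_self y m

theorem transvection_of_ne {x y : X} (h : x ≠ y) (m : X → ℤ) :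
    transvection y m (of x) = of x * of y ^ m x :=
  transvectionHom_of_ne h m

theorem transvection_mul (y : X) (m n : X → ℤ) :
    transvection y m * transvection y n = transvection y (m + n) :=
  MulEquiv.ext fun g => DFunLike.congr_fun (transvectionHom_comp y m n) g

theorem transvection_inv (y : X) (m : X → ℤ) : (transvection y m)⁻¹ = transvection y (-m) :=
  inv_eq_of_mul_eq_one_right <| by
    rw [transvection_mul, add_neg_cancel]
    exact MulEquiv.ext fun g => DFunLike.congr_fun (transvectionHom_zero y) g

theorem letterCount_transvection_le (y : X) (m : X → ℤ) (g : FreeGroup X) :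
    letterCount (fun x => decide (x ≠ y)) (transvection y m g) ≤
      letterCount (fun x => decide (x ≠ y)) g := by
  set p : X → Bool := fun x => decide (x ≠ y) with hp
  have hy (n : ℤ) : letterCount p (of y ^ n) = 0 := by
    simpa [letterCount, hp] using letterCount_zpow_le p (of y) n
  have hx (x : X) : letterCount p (transvection y m (of x)) ≤ if x = y then 0 else 1 := by
    split_ifs with h
    · subst h
      simpa using (hy 1).le
    · rw [transvection_of_ne h]
      refine (letterCount_mul_le p _ _).trans ?_
      rw [hy]
      simp [letterCount, hp, h]
  have hL (L : List (X × Bool)) :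
      letterCount p (transvection y m (mk L)) ≤ L.countP fun a => p a.1 := by
    induction L with
    | nil => simp [← one_eq_mk, letterCount]
    | cons a L ih =>
      rw [← List.singleton_append, ← mul_mk, _root_.map_mul, List.countP_append]
      refine (letterCount_mul_le p _ _).trans (add_le_add ?_ ih)
      obtain ⟨x, b⟩ := a
      have hb : letterCount p (transvection y m (mk [(x, b)])) =
          letterCount p (transvection y m (of x)) := by
        cases b
        · rw [← letterCount_inv, ← _root_.map_inv]
          rfl
        · rfl
      rw [hb]
      refine (hx x).trans ?_
      by_cases h : x = y <;> simp [hp, h]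
  conv_lhs => rw [← mk_toWord (x := g)]
  exact hL _

end Transvection

section SmallNormal

open scoped Classical in
theorem exists_transvection_commute [Infinite X] {N : Subgroup (MulAut (FreeGroup X))}
    (hN : N.Normal) (hcard : #N ≤ #X) {φ : MulAut (FreeGroup X)} (hφ : φ ∈ N) (y : X) :
    ∃ x ≠ y, ∀ n : ℤ, ∃ m : X → ℤ, m x = n ∧ Commute (transvection y m) φ := by
  have hX : #N ≤ #({y}ᶜ : Set X) := by
    rw [mk_compl_of_infinite _ (by simpa using (one_lt_aleph0.trans_le (aleph0_le_mk X)))]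
    exact hcard
  obtain ⟨ι⟩ := hX
  have hcoord : ∃ x ≠ y, ∃ ψ : MulAut (FreeGroup X), ∀ n : ℤ, ∃ m : X → ℤ, m x = n ∧
      transvection y m * φ * (transvection y m)⁻¹ = ψ := by
    by_contra! hbad
    choose f hf using hbad
    let e : ({y}ᶜ : Set X) → N := Function.invFun ι
    let m : X → ℤ := fun x => if h : x ≠ y then f x h (e ⟨x, h⟩) else 0
    let ψ : N := ⟨_, hN.conj_mem φ hφ (transvection y m)⟩
    have hψ : e (ι ψ) = ψ := Function.leftInverse_invFun ι.injective ψ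
    refine hf (ι ψ) (ι ψ).2 ψ m ?_ rfl
    have hne : (ι ψ : X) ≠ y := (ι ψ).2
    simp only [m, dif_pos hne, hψ]
  obtain ⟨x, hx, ψ, hψ⟩ := hcoord
  obtain ⟨m₀, hm₀, h₀⟩ := hψ 0
  refine ⟨x, hx, fun n => ?_⟩
  obtain ⟨m, hm, h⟩ := hψ n
  refine ⟨-m₀ + m, by simp [hm₀, hm], ?_⟩
  rw [← transvection_mul, ← transvection_inv, commute_iff_eq]
  rw [← h₀, mul_inv_eq_iff_eq_mul] at h
  rw [mul_assoc, h]
  group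

open scoped Classical in
theorem exists_conj_zpow_of_mem [Infinite X] {N : Subgroup (MulAut (FreeGroup X))}
    (hN : N.Normal) (hcard : #N ≤ #X) {φ : MulAut (FreeGroup X)} (hφ : φ ∈ N) (y : X) :
    ∃ (k : ℤ) (c : FreeGroup X), φ (of y) = c * of y ^ k * c⁻¹ := by
  obtain ⟨x, hx, h⟩ := exists_transvection_commute hN hcard hφ y
  set p : X → Bool := fun x => decide (x ≠ y) with hp
  refine exists_conj_zpow_of_letterCount_le
    (K := letterCount p (φ (of x)) + letterCount p (φ (of x))) fun n => ?_
  obtain ⟨m, hm, hc⟩ := h n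
  have heq : φ (of y) ^ n = (φ (of x))⁻¹ * transvection y m (φ (of x)) := by
    have := DFunLike.congr_fun hc.eq (of x)
    rw [MulAut.mul_apply, MulAut.mul_apply, transvection_of_ne hx, hm] at this
    rw [this]
    simp
  rw [heq]
  refine (letterCount_mul_le _ _ _).trans (add_le_add ?_ (letterCount_transvection_le y m _))
  rw [letterCount_inv]


end SmallNormal

theorem map_mk_singleton {G : Type*} [Group G] (f : FreeGroup X →* G) (x : X) (b : Bool) :
    f (mk [(x, b)]) = cond b (f (of x)) (f (of x))⁻¹ := by
  cases b
  · exact _root_.map_inv f (of x)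
  · rfl

theorem mk_singleton_mem_zpowers (x : X) (b : Bool) :
    mk [(x, b)] ∈ Subgroup.zpowers (of x) :=
  mk_mem_zpowers_of (by simp)

section ExponentSum

variable [DecidableEq X]

/-- The sum of the exponents of the generator `x`. -/
def exponentSum (x : X) : FreeGroup X →* Multiplicative ℤ :=
  lift (Pi.mulSingle x (Multiplicative.ofAdd 1))

@[simp]
theorem exponentSum_of_self (x : X) : exponentSum x (of x) = Multiplicative.ofAdd 1 := by
  simp [exponentSum]

theorem exponentSum_of_ne {x y : X} (h : y ≠ x) : exponentSum x (of y) = 1 := by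
  simp [exponentSum, h]

theorem exists_conj_mk_singleton {φ : MulAut (FreeGroup X)}
    (h : ∀ x, ∃ (k : ℤ) (c : FreeGroup X), φ (of x) = c * of x ^ k * c⁻¹) (x : X) :
    ∃ (b : Bool) (c : FreeGroup X), φ (of x) = c * mk [(x, b)] * c⁻¹ := by
  choose k c hc using h
  have hcomp : (exponentSum x).comp φ.toMonoidHom =
      (zpowGroupHom (k x)).comp (exponentSum x) := by
    ext a
    by_cases ha : a = x
    · subst ha
      simp [hc]
    · simp [hc, exponentSum_of_ne ha]
  have hone := DFunLike.congr_fun hcomp (φ.symm (of x))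
  have hmul : (exponentSum x (φ.symm (of x))).toAdd * k x = 1 := by
    simpa [mul_comm, eq_comm] using congrArg Multiplicative.toAdd hone
  rcases Int.eq_one_or_neg_one_of_mul_eq_one' hmul with ⟨-, hk⟩ | ⟨-, hk⟩
  · exact ⟨true, c x, by rw [hc, hk, zpow_one]; rfl⟩
  · exact ⟨false, c x, by rw [hc, hk, zpow_neg_one]; rfl⟩

end ExponentSum

/-- Every member `α (of x)` of a basis of the free group is sent by `φ` to a conjugate of itself or
of its inverse. -/
def PreservesPrimitives (φ : MulAut (FreeGroup X)) : Prop :=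
  ∀ (α : MulAut (FreeGroup X)) (x : X), ∃ (b : Bool) (c : FreeGroup X),
    φ (α (of x)) = c * α (mk [(x, b)]) * c⁻¹

theorem preservesPrimitives_of_mem [Infinite X] {N : Subgroup (MulAut (FreeGroup X))}
    (hN : N.Normal) (hcard : #N ≤ #X) {φ : MulAut (FreeGroup X)} (hφ : φ ∈ N) :
    PreservesPrimitives φ := by
  classical
  intro α x
  obtain ⟨b, c, h⟩ := exists_conj_mk_singleton (exists_conj_zpow_of_mem hN hcard
    (by simpa using hN.conj_mem φ hφ α⁻¹ : α⁻¹ * φ * α ∈ N)) x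
  refine ⟨b, α c, ?_⟩
  rw [← _root_.map_inv, ← _root_.map_mul, ← _root_.map_mul, ← h]
  simp [MulAut.mul_apply]

theorem PreservesPrimitives.conj_mul {φ : MulAut (FreeGroup X)} (h : PreservesPrimitives φ)
    (g : FreeGroup X) : PreservesPrimitives (MulAut.conj g * φ) := by
  intro α x
  obtain ⟨b, c, hc⟩ := h α x
  refine ⟨b, g * c, ?_⟩
  rw [MulAut.mul_apply, hc, MulAut.conj_apply]
  group

theorem isReduced_invRev {L : List (X × Bool)} (h : IsReduced L) : IsReduced (invRev L) := by
  classical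
  rw [isReduced_iff_reduce_eq] at h ⊢
  rw [reduce_invRev, h]

theorem isCyclicallyReduced_conj_append {L : List (X × Bool)} (hL : IsReduced L)
    (hne : L ≠ []) {x y : X} (b b' : Bool)
    (hhead : ∀ a ∈ L.head?, a.1 ≠ y) (hlast : ∀ a ∈ L.getLast?, a.1 ≠ x) :
    IsCyclicallyReduced (L ++ [(x, b)] ++ invRev L ++ [(y, b')]) := by
  have hinv := isReduced_invRev hL
  obtain ⟨u, hu⟩ : ∃ u, L.head? = some u := ⟨_, List.head?_eq_some_head hne⟩
  obtain ⟨v, hv⟩ : ∃ v, L.getLast? = some v := ⟨_, List.getLast?_eq_some_getLast hne⟩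
  have hu' : (invRev L).getLast? = some (u.1, !u.2) := by simp [invRev, hu]
  have hv' : (invRev L).head? = some (v.1, !v.2) := by simp [invRev, hv]
  have huy : u.1 ≠ y := hhead u hu
  have hvx : v.1 ≠ x := hlast v hv
  refine ⟨?_, ?_⟩
  · rw [IsReduced, List.isChain_append, List.isChain_append, List.isChain_append]
    refine ⟨⟨⟨hL, .singleton _, ?_⟩, hinv, ?_⟩, .singleton _, ?_⟩
    · simp [hv, hvx]
    · simp [hv', hvx.symm]
    · rw [List.getLast?_append, hu']
      simp [huy]
  · rw [List.getLast?_concat]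
    simp [List.head?_append, hu, huy.symm]

/-- Letters `y` at the start and letters `x` at the end of the conjugator `L` can be absorbed. -/
theorem exists_conj_zpow_of_cancel {x y : X} {b : Bool} {g : FreeGroup X}
    (key : ∀ (L : List (X × Bool)) (a : ℤ), IsReduced L →
      g = of y ^ a * (mk L * mk [(x, b)] * (mk L)⁻¹) * (of y ^ a)⁻¹ →
      (∀ l ∈ L.head?, l.1 ≠ y) → (∀ l ∈ L.getLast?, l.1 ≠ x) → L = [])
    (L : List (X × Bool)) (a : ℤ) (hL : IsReduced L)
    (hg : g = of y ^ a * (mk L * mk [(x, b)] * (mk L)⁻¹) * (of y ^ a)⁻¹) :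
    ∃ a : ℤ, g = of y ^ a * mk [(x, b)] * (of y ^ a)⁻¹ := by
  induction hn : L.length using Nat.strong_induction_on generalizing L a with
  | _ n ih =>
    subst hn
    by_cases hhead : ∀ l ∈ L.head?, l.1 ≠ y
    · by_cases hlast : ∀ l ∈ L.getLast?, l.1 ≠ x
      · obtain rfl := key L a hL hg hhead hlast
        exact ⟨a, by simpa [← one_eq_mk] using hg⟩
      · push Not at hlast
        obtain ⟨⟨z, s⟩, hl, rfl⟩ := hlast
        obtain ⟨L', rfl⟩ := List.getLast?_eq_some_iff.mp hl
        refine ih L'.length (by simp) L' a (List.IsChain.left_of_append hL) ?_ rfl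
        rw [hg, ← mul_mk]
        obtain ⟨i, hi⟩ := mk_singleton_mem_zpowers z b
        obtain ⟨j, hj⟩ := mk_singleton_mem_zpowers z s
        dsimp only at hi hj ⊢
        rw [← hi, ← hj]
        group
    · push Not at hhead
      obtain ⟨⟨z, s⟩, hl, rfl⟩ := hhead
      obtain ⟨L', rfl⟩ := List.head?_eq_some_iff.mp hl
      obtain ⟨j, hj⟩ := mk_singleton_mem_zpowers z s
      refine ih L'.length (by simp) L' (a + j) (List.IsChain.tail hL) ?_ rfl
      rw [hg, ← List.singleton_append, ← mul_mk]
      dsimp only at hj ⊢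
      rw [← hj]
      group

theorem PreservesPrimitives.exists_conj_zpow {φ : MulAut (FreeGroup X)}
    (h : PreservesPrimitives φ) {x y : X} (hxy : x ≠ y) {b : Bool}
    (hy : φ (of y) = mk [(y, b)]) :
    ∃ a : ℤ, φ (of x) = of y ^ a * mk [(x, b)] * (of y ^ a)⁻¹ := by
  classical
  obtain ⟨b', d, hd⟩ := h 1 x
  obtain ⟨k, c, hc⟩ := h (transvection y (Pi.single x 1)) x
  have hτ : transvection y (Pi.single x 1) (of x) = of x * of y := by
    simp [transvection_of_ne hxy]
  have hτk : transvection y (Pi.single x 1) (mk [(x, k)]) =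
      cond k (of x * of y) (of x * of y)⁻¹ := by
    rw [← hτ]
    exact map_mk_singleton (transvection y (Pi.single x 1)).toMonoidHom x k
  rw [hτ, hτk] at hc
  simp only [MulAut.one_apply] at hd
  have hbk : b = k := by
    have := congrArg (exponentSum y) hc
    rw [_root_.map_mul φ, hd, hy] at this
    simp only [_root_.map_mul, _root_.map_inv, map_mk_singleton, exponentSum_of_self,
      exponentSum_of_ne hxy, Bool.apply_cond] at this
    revert this
    cases b <;> cases b' <;> cases k <;> simp <;> decide
  have hbk' : b' = k := by
    have := congrArg (exponentSum x) hc
    rw [_root_.map_mul φ, hd, hy] at this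
    simp only [_root_.map_mul, _root_.map_inv, map_mk_singleton, exponentSum_of_self,
      exponentSum_of_ne hxy.symm, Bool.apply_cond] at this
    revert this
    cases b <;> cases b' <;> cases k <;> simp <;> decide
  obtain rfl : b' = b := hbk'.trans hbk.symm
  refine exists_conj_zpow_of_cancel (fun L a hL hg hhead hlast => ?_) d.toWord 0
    isReduced_toWord (by simpa [mk_toWord] using hd)
  by_contra hne
  have hcyc := isCyclicallyReduced_conj_append hL hne b' b' hhead hlast
  have hlen := length_le_of_isCyclicallyReduced hcyc (c := (of y ^ a)⁻¹ * c)
    (g := cond k (of x * of y) (of x * of y)⁻¹) (by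
      obtain ⟨j, hj⟩ := mk_singleton_mem_zpowers y b'
      dsimp only at hj
      have : (of y ^ a)⁻¹ * φ (of x * of y) * of y ^ a =
          (of y ^ a)⁻¹ * c * cond k (of x * of y) (of x * of y)⁻¹ * ((of y ^ a)⁻¹ * c)⁻¹ := by
        rw [hc]
        group
      rw [← this, _root_.map_mul φ, hy, hg, ← mul_mk, ← mul_mk, ← mul_mk, ← inv_mk, ← hj]
      group)
  have hnorm : norm (cond k (of x * of y) (of x * of y)⁻¹) ≤ 2 := by
    have := norm_mul_le (of x) (of y)
    cases k <;> simpa [-mul_inv_rev, norm_inv_eq] using this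
  have hpos := List.length_pos_iff.mpr hne
  simp only [List.length_append, invRev_length, List.length_singleton] at hlen
  omega

theorem addRight_one_zpow_apply (a n : ℤ) : (Equiv.addRight (1 : ℤ) ^ a) n = n + a := by
  induction a using Int.induction_on generalizing n with
  | zero => simp
  | succ i ih => rw [zpow_add_one, Equiv.Perm.mul_apply, ih, Equiv.coe_addRight]; ring
  | pred i ih =>
    rw [zpow_sub_one, Equiv.Perm.mul_apply, ih, Equiv.Perm.inv_def, Equiv.addRight_symm,
      Equiv.coe_addRight]
    ring

/-- Conjugates of one generator by powers of two other generators agree only trivially. -/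
theorem zpow_eq_zero_of_conj_eq {w y z : X} (hyz : z ≠ y) (hwy : w ≠ y) (hwz : z ≠ w)
    {b : Bool} {a a' : ℤ} (h : of y ^ a * mk [(z, b)] * (of y ^ a)⁻¹ =
      of w ^ a' * mk [(z, b)] * (of w ^ a')⁻¹) : a = 0 := by
  classical
  let f : FreeGroup X →* Equiv.Perm ℤ := lift fun x =>
    if x = y then Equiv.addRight 1 else if x = z then Equiv.swap 0 1 else 1
  have hfy : f (of y) = Equiv.addRight 1 := by simp [f]
  have hfz : f (of z) = Equiv.swap 0 1 := by simp [f, hyz]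
  have hfw : f (of w) = 1 := by simp [f, hwy, hwz.symm]
  have hfb : f (mk [(z, b)]) = Equiv.swap 0 1 := by
    rw [map_mk_singleton, hfz]
    cases b <;> simp
  have hf := congrArg f h
  simp only [_root_.map_mul, _root_.map_inv, map_zpow, hfy, hfw, hfb, one_zpow, inv_one, one_mul,
    mul_one, mul_inv_eq_iff_eq_mul] at hf
  have h₁ := Equiv.congr_fun hf 0
  simp only [Equiv.Perm.mul_apply, Equiv.swap_apply_left, addRight_one_zpow_apply,
    Equiv.swap_apply_def] at h₁
  split_ifs at h₁ <;> omega

theorem PreservesPrimitives.mem_range_conj [Infinite X] {φ : MulAut (FreeGroup X)}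
    (h : PreservesPrimitives φ) : φ ∈ (MulAut.conj : FreeGroup X →* MulAut (FreeGroup X)).range := by
  classical
  obtain ⟨y⟩ : Nonempty X := inferInstance
  obtain ⟨w, hw⟩ := Infinite.exists_notMem_finset {y}
  obtain ⟨z, hz⟩ := Infinite.exists_notMem_finset {y, w}
  simp only [Finset.mem_singleton, Finset.mem_insert, not_or] at hw hz
  obtain ⟨b, c, hc⟩ := h 1 y
  obtain ⟨a, ha⟩ := (h.conj_mul c⁻¹).exists_conj_zpow hw (b := b)
    (by simpa [MulAut.mul_apply, mul_assoc] using congrArg (fun g => c⁻¹ * g * c) hc)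
  set g := (of y ^ a)⁻¹ * c⁻¹ with hg
  have hψ := h.conj_mul g
  have hψy : (MulAut.conj g * φ) (of y) = mk [(y, b)] := by
    obtain ⟨j, hj⟩ := mk_singleton_mem_zpowers y b
    simp only [MulAut.one_apply] at hc hj
    rw [MulAut.mul_apply, MulAut.conj_apply, hc, ← hj, hg]
    group
  have hψw : (MulAut.conj g * φ) (of w) = mk [(w, b)] := by
    rw [MulAut.mul_apply, MulAut.conj_apply] at ha ⊢
    have : g * φ (of w) * g⁻¹ = (of y ^ a)⁻¹ * (c⁻¹ * φ (of w) * c⁻¹⁻¹) * of y ^ a := by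
      rw [hg]
      group
    rw [this, ha]
    group
  set ψ := MulAut.conj g * φ with hψdef
  have hψx (x : X) : ψ (of x) = mk [(x, b)] := by
    by_cases hxy : x = y
    · rw [hxy, hψy]
    by_cases hxw : x = w
    · rw [hxw, hψw]
    obtain ⟨i, hi⟩ := hψ.exists_conj_zpow hxy hψy
    obtain ⟨j, hj⟩ := hψ.exists_conj_zpow hxw hψw
    have := zpow_eq_zero_of_conj_eq hxy hw hxw (hi.symm.trans hj)
    simpa [this] using hi
  have hb : b = true := by
    by_contra hb
    obtain rfl : b = false := by simpa using hb
    obtain ⟨k, d, hd⟩ := hψ (transvection y (Pi.single w 1) * transvection z (Pi.single w 1)) w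
    let f : FreeGroup X →* Equiv.Perm (Fin 3) := lift fun x =>
      if x = w then Equiv.swap 0 1 else if x = z then Equiv.swap 1 2 else
        (Equiv.swap 1 2 * Equiv.swap 0 1)⁻¹
    have hfw : f (of w) = Equiv.swap 0 1 := by simp [f]
    have hfz : f (of z) = Equiv.swap 1 2 := by simp [f, hz.2]
    have hfy : f (of y) = (Equiv.swap 1 2 * Equiv.swap 0 1)⁻¹ := by
      simp [f, Ne.symm hw, Ne.symm hz.1]
    set α := transvection y (Pi.single w 1) * transvection z (Pi.single w 1) with hα
    have hαw : α (of w) = of w * of y * of z := by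
      rw [hα, MulAut.mul_apply, transvection_of_ne (Ne.symm hz.2), _root_.map_mul,
        transvection_of_ne hw, _root_.map_zpow, transvection_of_ne hz.1]
      simp [hz.2]
    have hfα : f (α (mk [(w, k)])) = 1 := by
      have := map_mk_singleton (f.comp α.toMonoidHom) w k
      have h₁ : f (α (of w)) = 1 := by
        rw [hαw, _root_.map_mul, _root_.map_mul, hfw, hfy, hfz]
        decide
      simpa [h₁] using this
    have hf := congrArg f hd
    rw [_root_.map_mul f, _root_.map_mul f, hfα, hαw, _root_.map_mul ψ, _root_.map_mul ψ,
      hψx, hψx, hψx, _root_.map_mul f, _root_.map_mul f, map_mk_singleton, map_mk_singleton,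
      map_mk_singleton, hfw, hfy, hfz, mul_one, _root_.map_inv, mul_inv_cancel] at hf
    revert hf
    decide
  have hone : ψ = 1 := by
    ext1 v
    have : ψ.toMonoidHom = MonoidHom.id _ := by
      ext x
      simp [hψx, hb]
      rfl
    exact DFunLike.congr_fun this v
  refine ⟨g⁻¹, ?_⟩
  rw [_root_.map_inv, inv_eq_iff_mul_eq_one]
  exact hone

theorem mk_range_conj [Infinite X] :
    #((MulAut.conj : FreeGroup X →* MulAut (FreeGroup X)).range) = #X := by
  apply le_antisymm
  · refine mk_range_le.trans ?_
    rw [mk_freeGroup, max_eq_left (aleph0_le_mk X)]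
  · refine mk_le_of_injective (f := fun x : X => (⟨MulAut.conj (of x), of x, rfl⟩ :
      (MulAut.conj : FreeGroup X →* MulAut (FreeGroup X)).range)) fun x y hxy => ?_
    by_contra hne
    classical
    obtain ⟨w, hw⟩ := Infinite.exists_notMem_finset {x, y}
    simp only [Finset.mem_singleton, Finset.mem_insert, not_or] at hw
    have h := DFunLike.congr_fun (congrArg Subtype.val hxy) (of x)
    simp only [MulAut.conj_apply, mul_inv_cancel_right] at h
    refine one_ne_zero (zpow_eq_zero_of_conj_eq hne hw.2 (Ne.symm hw.1) (b := true) (a := 1)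
      (a' := 0) ?_)
    simpa using! h.symm

end FreeGroup

/-- For a free group `F = FreeGroup X` of infinite rank, `Inn F` (the range of the
conjugation homomorphism `F →* Aut F`) is a normal subgroup of `Aut F` of cardinality
`#X`, and every normal subgroup of `Aut F` of cardinality at most `#X` is contained in
`Inn F`; thus `Inn F` is the largest normal subgroup of `Aut F` of cardinality `#X`. -/
theorem inn_largest_small_normal_subgroup {X : Type*} [Infinite X] :
    ((MulAut.conj : FreeGroup X →* MulAut (FreeGroup X)).range).Normal ∧
    Cardinal.mk ((MulAut.conj : FreeGroup X →* MulAut (FreeGroup X)).range) =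
      Cardinal.mk X ∧
    ∀ N : Subgroup (MulAut (FreeGroup X)), N.Normal → Cardinal.mk N ≤ Cardinal.mk X →
      N ≤ (MulAut.conj : FreeGroup X →* MulAut (FreeGroup X)).range := by
  refine ⟨⟨?_⟩, FreeGroup.mk_range_conj, fun N hN hcard φ hφ =>
    (FreeGroup.preservesPrimitives_of_mem hN hcard hφ).mem_range_conj⟩
  rintro _ ⟨g, rfl⟩ α
  refine ⟨α g, ?_⟩
  ext h
  simp [MulAut.mul_apply]
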